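/- Let X ∈ K. Then: (a) H_X^⊥ = { W ∈ L²(Ω) : W = 0 almost everywhere on Ω ∖ Ω_X and ∫_α^β W(m) dm = 0 for every connected component (α,β) of Ω_X }; (b) H_X^⊥ is the smallest closed linear subspace of L²(Ω) containing the normal cone N_X K; (c) H_X^⊥ = { W ∈ L²(Ω) : ∫₀¹ W(m) φ(X(m)) dm = 0 for every bounded continuous φ : ℝ → ℝ }. -/

import Mathlib

open MeasureTheory Set Filter
open scoped ENNReal NNReal RealInnerProductSpace

noncomputable section

/-- The interval `Ω = (0,1)`. -/
def Omg : Set ℝ := Set.Ioo 0 1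

/-- Lebesgue measure restricted to `(0,1)`. -/
def mu : Measure ℝ := volume.restrict Omg

/-- The Hilbert space `L²(Ω)`. -/
abbrev L2 : Type := Lp ℝ 2 mu

/-- The cone `K` of functions in `L²(Ω)` admitting a nondecreasing representative. -/
def Kcone : Set L2 := {X | ∃ g : ℝ → ℝ, MonotoneOn g Omg ∧ ⇑X =ᵐ[mu] g}

/-- The normal cone to `K` at `X`. -/
def normalCone (X : L2) : Set L2 := {W | ∀ Y ∈ Kcone, ⟪W, Y - X⟫ ≤ 0}

/-- `Ω_X`: points of `Ω` near which `X` is (essentially) constant. -/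
def OmegaX (X : L2) : Set ℝ :=
  {m | m ∈ Omg ∧ ∃ U ∈ nhds m, ∃ c : ℝ, ∀ᵐ x ∂(mu.restrict U), X x = c}

/-- The closed subspace `H_X` of functions admitting a representative that is constant on
each connected component of `Ω_X`. -/
def HX (X : L2) : Set L2 :=
  {U | ∃ g : ℝ → ℝ, ⇑U =ᵐ[mu] g ∧
    ∀ m ∈ OmegaX X, ∀ m' ∈ connectedComponentIn (OmegaX X) m, g m' = g m}

/-- The orthogonal complement `H_X^⊥`. -/
def HXperp (X : L2) : Set L2 := {W | ∀ U ∈ HX X, ⟪W, U⟫ = 0}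

instance : IsFiniteMeasure mu := by
  unfold mu Omg
  infer_instance

/-- The level set of `g` in `Ω` at height `v`. -/
def levelSet (g : ℝ → ℝ) (v : ℝ) : Set ℝ := Omg ∩ g ⁻¹' {v}

/-- The heights whose level sets have nonempty interior. -/
def plateauHeights (g : ℝ → ℝ) : Set ℝ := {v | (interior (levelSet g v)).Nonempty}

/-- The generalized inverse `v ↦ sup {x ∈ Ω : g x ≤ v}`. -/
def upperInverse (g : ℝ → ℝ) (v : ℝ) : ℝ := sSup (insert 0 {x | x ∈ Omg ∧ g x ≤ v})

lemma bddAbove_sublevel (g : ℝ → ℝ) (v : ℝ) : BddAbove (insert 0 {x | x ∈ Omg ∧ g x ≤ v}) := by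
  refine ⟨1, ?_⟩
  rintro x (rfl | ⟨hx, -⟩)
  · norm_num
  · exact hx.2.le

lemma monotone_upperInverse (g : ℝ → ℝ) : Monotone (upperInverse g) := fun _ w hvw =>
  csSup_le_csSup (bddAbove_sublevel g w) (insert_nonempty _ _)
    (insert_subset_insert fun _ hx => ⟨hx.1, hx.2.trans hvw⟩)

lemma interior_levelSet_subset (g : ℝ → ℝ) (v : ℝ) : interior (levelSet g v) ⊆ Omg :=
  interior_subset.trans inter_subset_left

lemma eq_of_mem_interior_levelSet {g : ℝ → ℝ} {v x : ℝ} (hx : x ∈ interior (levelSet g v)) :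
    g x = v := (interior_subset hx).2

lemma disjoint_interior_levelSet (g : ℝ → ℝ) {v w : ℝ} (h : v ≠ w) :
    Disjoint (interior (levelSet g v)) (interior (levelSet g w)) :=
  Set.disjoint_left.2 fun _ hv hw =>
    h ((eq_of_mem_interior_levelSet hv).symm.trans (eq_of_mem_interior_levelSet hw))

lemma countable_plateauHeights (g : ℝ → ℝ) : (plateauHeights g).Countable :=
  Set.PairwiseDisjoint.countable_of_isOpen (s := fun v => interior (levelSet g v))
    (fun _ _ _ _ h => disjoint_interior_levelSet g h) (fun _ _ => isOpen_interior) fun _ h => h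

lemma ordConnected_levelSet {g : ℝ → ℝ} (hg : MonotoneOn g Omg) (v : ℝ) :
    (levelSet g v).OrdConnected := by
  refine ⟨fun x hx y hy z hz => ?_⟩
  have hzO : z ∈ Omg := ⟨hx.1.1.trans_le hz.1, hz.2.trans_lt hy.1.2⟩
  have h1 := hg hx.1 hzO hz.1
  have h2 := hg hzO hy.1 hz.2
  have h3 : g x = v := hx.2
  have h4 : g y = v := hy.2
  exact ⟨hzO, show g z = v by linarith⟩

lemma ordConnected_interior_levelSet {g : ℝ → ℝ} (hg : MonotoneOn g Omg) (v : ℝ) :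
    (interior (levelSet g v)).OrdConnected :=
  (ordConnected_levelSet hg v).convex.interior.ordConnected

lemma eq_of_ae_const {g : ℝ → ℝ} {a b c x : ℝ} (hg : MonotoneOn g (Ioo a b))
    (hc : ∀ᵐ y ∂volume, y ∈ Ioo a b → g y = c) (hx : x ∈ Ioo a b) : g x = c := by
  have key : ∀ p q, p < q → Ioo p q ⊆ Ioo a b → ∃ y ∈ Ioo p q, g y = c := by
    intro p q hpq hsub
    by_contra! hcon
    have hz : volume (Ioo p q) = 0 := by
      refine measure_mono_null (fun y hy => ?_) (ae_iff.1 hc)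
      exact fun h => hcon y hy (h (hsub hy))
    simp [Real.volume_Ioo] at hz
    linarith
  obtain ⟨y, hy, hyc⟩ := key a x hx.1 (Ioo_subset_Ioo_right hx.2.le)
  obtain ⟨z, hz, hzc⟩ := key x b hx.2 (Ioo_subset_Ioo_left hx.1.le)
  have h1 := hg ⟨hy.1, hy.2.trans hx.2⟩ hx hy.2.le
  have h2 := hg hx ⟨hx.1.trans hz.1, hz.2⟩ hz.1.le
  linarith

lemma mem_OmegaX_iff {X : L2} {g : ℝ → ℝ} (hg : MonotoneOn g Omg) (hX : ⇑X =ᵐ[mu] g) {m : ℝ} :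
    m ∈ OmegaX X ↔ m ∈ interior (levelSet g (g m)) := by
  constructor
  · rintro ⟨hm, U, hU, c, hc⟩
    have hO : Omg ∈ nhds m := isOpen_Ioo.mem_nhds hm
    obtain ⟨a, b, hab, hsub⟩ := mem_nhds_iff_exists_Ioo_subset.1 (inter_mem hU hO)
    have hc' : ∀ᵐ y ∂volume, y ∈ Ioo a b → g y = c := by
      rw [← ae_restrict_iff' measurableSet_Ioo]
      have hle : volume.restrict (Ioo a b) ≤ mu.restrict U := by
        rw [mu, ← Measure.restrict_restrict_of_subset (s := Ioo a b) (t := Omg)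
          (hsub.trans inter_subset_right)]
        exact Measure.restrict_mono (hsub.trans inter_subset_left) le_rfl
      have h1 := ae_mono hle hc
      have h2 := ae_mono hle (ae_restrict_of_ae hX)
      filter_upwards [h1, h2] with y hy1 hy2
      rw [← hy2, hy1]
    have hgab := hg.mono (hsub.trans inter_subset_right)
    refine mem_interior.2 ⟨Ioo a b, fun x hx => ⟨(hsub hx).2, ?_⟩, isOpen_Ioo, hab⟩
    exact (eq_of_ae_const hgab hc' hx).trans (eq_of_ae_const hgab hc' hab).symm
  · intro hm
    refine ⟨interior_levelSet_subset g _ hm, levelSet g (g m), mem_interior_iff_mem_nhds.1 hm,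
      g m, ?_⟩
    filter_upwards [ae_restrict_of_ae hX,
      ae_restrict_mem (ordConnected_levelSet hg (g m)).measurableSet] with x hx hxL
    exact hx.trans hxL.2

lemma mem_OmegaX_of_mem {X : L2} {g : ℝ → ℝ} (hg : MonotoneOn g Omg) (hX : ⇑X =ᵐ[mu] g) {m v : ℝ}
    (hm : m ∈ interior (levelSet g v)) : m ∈ OmegaX X := by
  rw [mem_OmegaX_iff hg hX, eq_of_mem_interior_levelSet hm]
  exact hm

lemma connectedComponentIn_OmegaX {X : L2} {g : ℝ → ℝ} (hg : MonotoneOn g Omg)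
    (hX : ⇑X =ᵐ[mu] g) {m : ℝ} (hm : m ∈ OmegaX X) :
    connectedComponentIn (OmegaX X) m = interior (levelSet g (g m)) := by
  have hm' := (mem_OmegaX_iff hg hX).1 hm
  apply Subset.antisymm
  · refine isPreconnected_connectedComponentIn.subset_left_of_subset_union isOpen_interior
      (v := ⋃ w ∈ {w | w ≠ g m}, interior (levelSet g w))
      (isOpen_biUnion fun _ _ => isOpen_interior) ?_ ?_ ⟨m, mem_connectedComponentIn hm, hm'⟩
    · exact disjoint_iUnion₂_right.2 fun w hw => disjoint_interior_levelSet g hw.symm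
    · intro x hx
      have hx' := (mem_OmegaX_iff hg hX).1 (connectedComponentIn_subset _ _ hx)
      by_cases h : g x = g m
      · left
        rwa [← h]
      · right
        exact mem_biUnion (show g x ∈ {w | w ≠ g m} from h) hx'
  · exact (ordConnected_interior_levelSet hg _).isPreconnected.subset_connectedComponentIn hm'
      fun x hx => mem_OmegaX_of_mem hg hX hx

lemma ae_mem_interior_levelSet {X : L2} {g : ℝ → ℝ} (hg : MonotoneOn g Omg)
    (hX : ⇑X =ᵐ[mu] g) :
    ∀ᵐ x ∂mu, x ∈ Omg ∧ X x = g x ∧ (g x ∈ plateauHeights g → x ∈ interior (levelSet g (g x))) := by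
  have hO : ∀ᵐ x ∂mu, x ∈ Omg := ae_restrict_mem measurableSet_Ioo
  have hN : ∀ᵐ x ∂mu, ∀ v ∈ plateauHeights g, x ∉ frontier (levelSet g v) := by
    refine ae_restrict_of_ae ?_
    rw [ae_ball_iff (countable_plateauHeights g)]
    intro v _
    exact measure_eq_zero_iff_ae_notMem.1
      ((ordConnected_levelSet hg v).convex.addHaar_frontier volume)
  filter_upwards [hO, hX, hN] with x hxO hxX hxN
  refine ⟨hxO, hxX, fun hT => ?_⟩
  by_contra hcon
  exact hxN _ hT ⟨subset_closure ⟨hxO, rfl⟩, hcon⟩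

lemma mem_OmegaX_iff_mem_plateauHeights {X : L2} {g : ℝ → ℝ} (hg : MonotoneOn g Omg)
    (hX : ⇑X =ᵐ[mu] g) : ∀ᵐ x ∂mu, x ∈ OmegaX X ↔ X x ∈ plateauHeights g := by
  filter_upwards [ae_mem_interior_levelSet hg hX] with x ⟨_, hxX, hxT⟩
  rw [hxX, mem_OmegaX_iff hg hX]
  exact ⟨fun h => ⟨x, h⟩, hxT⟩

lemma upperInverse_apply {g : ℝ → ℝ} (hg : MonotoneOn g Omg) {x : ℝ} (hx : x ∈ Omg)
    (hT : g x ∉ plateauHeights g) : upperInverse g (g x) = x := by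
  apply le_antisymm
  · refine csSup_le (insert_nonempty _ _) ?_
    rintro y (rfl | ⟨hy, hyx⟩)
    · exact hx.1.le
    · by_contra! hxy
      have hgy : g y = g x := le_antisymm hyx (hg hx hy hxy.le)
      refine hT ⟨(x + y) / 2, mem_interior.2 ⟨Ioo x y, fun z hz => ?_, isOpen_Ioo, ?_⟩⟩
      · exact (ordConnected_levelSet hg (g x)).out ⟨hx, rfl⟩ ⟨hy, hgy⟩ ⟨hz.1.le, hz.2.le⟩
      · constructor <;> linarith
  · exact le_csSup (bddAbove_sublevel g _) (mem_insert_of_mem _ ⟨hx, le_rfl⟩)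

lemma measurable_coeFn (X : L2) : Measurable X := (Lp.stronglyMeasurable X).measurable

lemma integrable_coeFn (W : L2) : Integrable W mu :=
  (Lp.memLp W).integrable (by norm_num)

/-- If `W` integrates to zero over every superlevel set
`{X ≥ v}` then it integrates to zero over every set of the `σ`-algebra generated by `X`. -/
lemma setIntegral_preimage_eq_zero {W X : L2} (htot : ∫ x, W x ∂mu = 0)
    (h : ∀ v, ∫ x in X ⁻¹' Ici v, W x ∂mu = 0) {B : Set ℝ} (hB : MeasurableSet B) :
    ∫ x in X ⁻¹' B, W x ∂mu = 0 := by
  have hmeas := measurable_coeFn X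
  have hint := integrable_coeFn W
  induction B, hB using MeasurableSpace.induction_on_inter
    ((BorelSpace.measurable_eq (α := ℝ)).trans (borel_eq_generateFrom_Ici ℝ)) isPiSystem_Ici with
  | empty => simp
  | basic t ht =>
    obtain ⟨v, rfl⟩ := ht
    exact h v
  | compl t ht ih =>
    rw [preimage_compl, setIntegral_compl (hmeas ht) hint, htot, ih, sub_zero]
  | iUnion f hd hf ih =>
    rw [preimage_iUnion, integral_iUnion (fun i => hmeas (hf i))
      (fun i j hij => (hd hij).preimage X) hint.integrableOn]
    simp [ih]

/-- The continuous ramp that vanishes below `v - 1/n` and equals one above `v`. -/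
def ramp (v : ℝ) (n : ℕ) (x : ℝ) : ℝ := max 0 (min 1 (1 + n * (x - v)))

lemma continuous_ramp (v : ℝ) (n : ℕ) : Continuous (ramp v n) := by
  unfold ramp
  fun_prop

lemma ramp_nonneg (v : ℝ) (n : ℕ) (x : ℝ) : 0 ≤ ramp v n x := le_max_left _ _

lemma ramp_le_one (v : ℝ) (n : ℕ) (x : ℝ) : ramp v n x ≤ 1 :=
  max_le zero_le_one (min_le_left _ _)

lemma abs_ramp_le_one (v : ℝ) (n : ℕ) (x : ℝ) : |ramp v n x| ≤ 1 := by
  rw [abs_of_nonneg (ramp_nonneg v n x)]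
  exact ramp_le_one v n x

lemma monotone_ramp (v : ℝ) (n : ℕ) : Monotone (ramp v n) := fun x y hxy => by
  unfold ramp
  gcongr

lemma ramp_sub_le (v : ℝ) (n : ℕ) {x y : ℝ} (hxy : x ≤ y) :
    ramp v n y - ramp v n x ≤ n * (y - x) := by
  have hn : 0 ≤ (n : ℝ) * (y - x) := mul_nonneg n.cast_nonneg (sub_nonneg.2 hxy)
  have h : ramp v n y ≤ ramp v n x + n * (y - x) := by
    refine max_le (add_nonneg (ramp_nonneg v n x) hn) ?_
    have h1 : min 1 (1 + (n : ℝ) * (x - v)) ≤ ramp v n x := le_max_right _ _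
    rcases min_cases 1 (1 + (n : ℝ) * (x - v)) with ⟨h2, _⟩ | ⟨h2, _⟩
    · linarith [min_le_left 1 (1 + (n : ℝ) * (y - v))]
    · linarith [min_le_right 1 (1 + (n : ℝ) * (y - v))]
  linarith

lemma tendsto_ramp (v x : ℝ) :
    Tendsto (fun n => ramp v n x) atTop (nhds ((Ici v).indicator (fun _ => 1) x)) := by
  by_cases hx : v ≤ x
  · rw [indicator_of_mem (mem_Ici.2 hx)]
    refine tendsto_const_nhds.congr fun n => ?_
    have : 0 ≤ (n : ℝ) * (x - v) := mul_nonneg n.cast_nonneg (sub_nonneg.2 hx)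
    rw [ramp, min_eq_left (by linarith), max_eq_right zero_le_one]
  · rw [indicator_of_notMem (by simpa using hx)]
    push Not at hx
    obtain ⟨N, hN⟩ := exists_nat_gt (1 / (v - x))
    refine tendsto_const_nhds.congr' ?_
    filter_upwards [eventually_ge_atTop N] with n hn
    have hvx : 0 < v - x := sub_pos.2 hx
    have h1 : 1 / (v - x) < n := hN.trans_le (Nat.cast_le.2 hn)
    rw [div_lt_iff₀ hvx] at h1
    have h2 : 1 + (n : ℝ) * (x - v) ≤ 0 := by linarith
    rw [ramp, max_eq_left ((min_le_right _ _).trans h2)]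

lemma setIntegral_preimage_eq_zero_of_ramp {W X : L2} (htot : ∫ x, W x ∂mu = 0)
    (h : ∀ v n, ∫ x, W x * ramp v n (X x) ∂mu = 0) {B : Set ℝ} (hB : MeasurableSet B) :
    ∫ x in X ⁻¹' B, W x ∂mu = 0 := by
  refine setIntegral_preimage_eq_zero htot (fun v => ?_) hB
  have hmeas := measurable_coeFn X
  have hlim : Tendsto (fun n => ∫ x, W x * ramp v n (X x) ∂mu) atTop
      (nhds (∫ x, W x * (Ici v).indicator (fun _ => 1) (X x) ∂mu)) := by
    refine tendsto_integral_of_dominated_convergence (fun x => |W x|) (fun n => ?_)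
      (integrable_coeFn W).abs (fun n => ?_) ?_
    · exact ((measurable_coeFn W).mul
        ((continuous_ramp v n).measurable.comp hmeas)).aestronglyMeasurable
    · refine Eventually.of_forall fun x => ?_
      rw [Real.norm_eq_abs, abs_mul]
      exact mul_le_of_le_one_right (abs_nonneg _) (abs_ramp_le_one v n _)
    · exact Eventually.of_forall fun x => (tendsto_ramp v (X x)).const_mul (W x)
  simp only [h] at hlim
  rw [← integral_indicator (hmeas measurableSet_Ici), tendsto_nhds_unique tendsto_const_nhds hlim]
  refine integral_congr_ae (Eventually.of_forall fun x => ?_)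
  by_cases hx : v ≤ X x <;> simp [indicator, hx]

lemma inner_eq_integral_mul (W U : L2) : ⟪W, U⟫ = ∫ x, W x * U x ∂mu := by
  rw [L2.inner_def]
  exact integral_congr_ae (Eventually.of_forall fun x => by simp [mul_comm])

lemma integrable_mul (W U : L2) : Integrable (fun x => W x * U x) mu :=
  (L2.integrable_inner (𝕜 := ℝ) W U).congr (Eventually.of_forall fun x => by simp [mul_comm])

lemma setIntegral_interior_levelSet {X : L2} {g : ℝ → ℝ} (f : ℝ → ℝ) (hg : MonotoneOn g Omg)
    (hX : ⇑X =ᵐ[mu] g) {v : ℝ} (hv : v ∈ plateauHeights g) :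
    ∫ x in interior (levelSet g v), f x = ∫ x in X ⁻¹' {v}, f x ∂mu := by
  rw [← Measure.restrict_restrict_of_subset (interior_levelSet_subset g v)]
  refine setIntegral_congr_set ?_
  filter_upwards [ae_mem_interior_levelSet hg hX] with x ⟨_, hxX, hxT⟩
  refine propext ⟨fun h => hxX.trans (eq_of_mem_interior_levelSet h), fun h => ?_⟩
  have hgv : g x = v := hxX.symm.trans h
  rw [hgv] at hxT
  exact hxT hv

/-- The characterization of `H_X^⊥` by vanishing off `Ω_X` and zero averages on components. -/
def VanishesWithZeroAverages (X W : L2) : Prop :=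
  (∀ᵐ m ∂mu, m ∉ OmegaX X → W m = 0) ∧
    ∀ m ∈ OmegaX X, (∫ s in connectedComponentIn (OmegaX X) m, W s) = 0

lemma vanishesWithZeroAverages_of_ramp {X W : L2} (hX : X ∈ Kcone) (htot : ∫ x, W x ∂mu = 0)
    (h : ∀ v n, ∫ x, W x * ramp v n (X x) ∂mu = 0) : VanishesWithZeroAverages X W := by
  obtain ⟨g, hg, hXg⟩ := hX
  have hB := fun {B : Set ℝ} => setIntegral_preimage_eq_zero_of_ramp (B := B) htot h
  have hT := (countable_plateauHeights g).measurableSet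
  have hXT : MeasurableSet (X ⁻¹' (plateauHeights g)ᶜ) := measurable_coeFn X hT.compl
  refine ⟨?_, fun m hm => ?_⟩
  · have hzero : (X ⁻¹' (plateauHeights g)ᶜ).indicator W =ᵐ[mu] 0 := by
      refine ((integrable_coeFn W).indicator hXT).ae_eq_zero_of_forall_setIntegral_eq_zero ?_
      intro E hE _
      rw [setIntegral_indicator hXT, ← hB
        (((monotone_upperInverse g).measurable hE).inter hT.compl)]
      refine setIntegral_congr_set ?_
      filter_upwards [ae_mem_interior_levelSet hg hXg] with x ⟨hxO, hxX, _⟩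
      refine propext (and_congr_left fun hxT => ?_)
      have hinv : upperInverse g (X x) = x := by
        rw [hxX]
        refine upperInverse_apply hg hxO ?_
        rw [← hxX]
        exact hxT
      change x ∈ E ↔ upperInverse g (X x) ∈ E
      rw [hinv]
    filter_upwards [hzero, mem_OmegaX_iff_mem_plateauHeights hg hXg] with x hx hxT hxO
    rwa [indicator_of_mem (show x ∈ X ⁻¹' (plateauHeights g)ᶜ from fun h => hxO (hxT.2 h))] at hx
  · rw [connectedComponentIn_OmegaX hg hXg hm,
      setIntegral_interior_levelSet W hg hXg ⟨m, (mem_OmegaX_iff hg hXg).1 hm⟩]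
    exact hB (measurableSet_singleton _)

lemma mem_HXperp_of_vanishesWithZeroAverages {X W : L2} (hX : X ∈ Kcone)
    (hW : VanishesWithZeroAverages X W) : W ∈ HXperp X := by
  obtain ⟨g, hg, hXg⟩ := hX
  rintro U ⟨f, hUf, hf⟩
  have : Countable (plateauHeights g) := (countable_plateauHeights g).to_subtype
  have hO : OmegaX X = ⋃ v : plateauHeights g, interior (levelSet g v) := by
    ext x
    rw [mem_iUnion]
    refine ⟨fun h => ?_, fun ⟨v, hv⟩ => mem_OmegaX_of_mem hg hXg hv⟩
    have h' := (mem_OmegaX_iff hg hXg).1 h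
    exact ⟨⟨g x, x, h'⟩, h'⟩
  have hmeas : MeasurableSet (OmegaX X) := by
    rw [hO]
    exact MeasurableSet.iUnion fun v => isOpen_interior.measurableSet
  have hint : Integrable (fun x => W x * f x) mu := by
    refine (integrable_mul W U).congr ?_
    filter_upwards [hUf] with x hx
    rw [hx]
  have h1 : ⟪W, U⟫ = ∫ x in OmegaX X, W x * f x ∂mu := by
    rw [inner_eq_integral_mul, ← integral_indicator hmeas]
    refine integral_congr_ae ?_
    filter_upwards [hUf, hW.1] with x hx hxW
    by_cases hxO : x ∈ OmegaX X
    · rw [indicator_of_mem hxO, hx]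
    · rw [indicator_of_notMem hxO, hxW hxO, zero_mul]
  rw [h1, hO, integral_iUnion (fun v => isOpen_interior.measurableSet)
    (fun v w hvw => disjoint_interior_levelSet g (Subtype.coe_injective.ne hvw))
    hint.integrableOn]
  rw [← tsum_zero (α := ℝ) (β := plateauHeights g)]
  refine tsum_congr fun v => ?_
  obtain ⟨m, hm⟩ := v.2
  have hmO := mem_OmegaX_of_mem hg hXg hm
  have hcomp := connectedComponentIn_OmegaX hg hXg hmO
  rw [eq_of_mem_interior_levelSet hm] at hcomp
  have hW0 := hW.2 m hmO
  rw [hcomp, ← Measure.restrict_restrict_of_subset (interior_levelSet_subset g v)] at hW0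
  change ∫ x in interior (levelSet g v), W x ∂mu = 0 at hW0
  rw [setIntegral_congr_fun (g := fun x => W x * f m) isOpen_interior.measurableSet
    fun x hx => ?_, integral_mul_const, hW0, zero_mul]
  have hfx : f x = f m := hf m hmO x (by rwa [hcomp])
  simp only [hfx]

lemma integral_mul_comp_eq_zero_of_mem_HXperp {X W : L2} (hX : X ∈ Kcone) (hW : W ∈ HXperp X)
    {φ : ℝ → ℝ} (hφ : Continuous φ) {M : ℝ} (hM : ∀ x, |φ x| ≤ M) :
    ∫ x, W x * φ (X x) ∂mu = 0 := by
  obtain ⟨g, hg, hXg⟩ := hX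
  have hmem : MemLp (fun x => φ (X x)) 2 mu :=
    MemLp.of_bound (hφ.measurable.comp (measurable_coeFn X)).aestronglyMeasurable M
      (Eventually.of_forall fun x => hM _)
  have hU : hmem.toLp _ ∈ HX X := by
    refine ⟨fun x => φ (g x), ?_, fun m hm m' hm' => ?_⟩
    · filter_upwards [hmem.coeFn_toLp, hXg] with x hx hxg
      rw [hx, hxg]
    · rw [connectedComponentIn_OmegaX hg hXg hm] at hm'
      simp only [eq_of_mem_interior_levelSet hm']
  rw [← hW _ hU, inner_eq_integral_mul]
  refine integral_congr_ae ?_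
  filter_upwards [hmem.coeFn_toLp] with x hx
  rw [hx]

/-- Perturbing `X` by `ε φ(X)` stays in the cone when `x ↦ x + ε φ(x)` is monotone. -/
lemma mul_integral_mul_comp_nonpos {X W : L2} (hX : X ∈ Kcone) (hW : W ∈ normalCone X)
    {φ : ℝ → ℝ} (hφ : Continuous φ) {M : ℝ} (hM : ∀ x, |φ x| ≤ M) {ε : ℝ}
    (hmono : Monotone fun x => x + ε * φ x) : ε * ∫ x, W x * φ (X x) ∂mu ≤ 0 := by
  obtain ⟨g, hg, hXg⟩ := hX
  have hmem : MemLp (fun x => φ (X x)) 2 mu :=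
    MemLp.of_bound (hφ.measurable.comp (measurable_coeFn X)).aestronglyMeasurable M
      (Eventually.of_forall fun x => hM _)
  have hY : X + ε • hmem.toLp _ ∈ Kcone := by
    refine ⟨fun x => g x + ε * φ (g x), fun x hx y hy hxy => hmono (hg hx hy hxy), ?_⟩
    filter_upwards [hmem.coeFn_toLp, hXg, Lp.coeFn_add X (ε • hmem.toLp _),
      Lp.coeFn_smul ε (hmem.toLp _)] with x h1 h2 h3 h4
    rw [h3, Pi.add_apply, h4, Pi.smul_apply, h1, h2, smul_eq_mul]
  have h := hW _ hY
  rw [add_sub_cancel_left, inner_smul_right, inner_eq_integral_mul] at h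
  convert! h using 2
  refine integral_congr_ae ?_
  filter_upwards [hmem.coeFn_toLp] with x hx
  rw [hx]

lemma mem_HXperp_of_mem_normalCone {X W : L2} (hX : X ∈ Kcone) (hW : W ∈ normalCone X) :
    W ∈ HXperp X := by
  refine mem_HXperp_of_vanishesWithZeroAverages hX (vanishesWithZeroAverages_of_ramp hX ?_ ?_)
  · have h := fun (ε : ℝ) => mul_integral_mul_comp_nonpos (φ := fun _ => 1) (M := 1) (ε := ε) hX hW
      continuous_const (by simp) fun x y hxy => by simpa using hxy
    have h1 := h 1
    have h2 := h (-1)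
    simp only [mul_one] at h1 h2
    linarith
  · intro v n
    have h1 := mul_integral_mul_comp_nonpos (ε := 1) hX hW (continuous_ramp v n)
      (abs_ramp_le_one v n) fun x y hxy => by
        have := monotone_ramp v n hxy
        simp only [one_mul]
        linarith
    have hpos : (0 : ℝ) < n + 1 := n.cast_add_one_pos
    have h2 := mul_integral_mul_comp_nonpos (ε := -(1 / (n + 1 : ℝ))) hX hW (continuous_ramp v n)
      (abs_ramp_le_one v n) fun x y hxy => by
        have h3 : 1 / (n + 1 : ℝ) * (ramp v n y - ramp v n x) ≤ y - x := by
          rw [div_mul_eq_mul_div, one_mul, div_le_iff₀ hpos]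
          linarith [ramp_sub_le v n hxy]
        change x + _ ≤ y + _
        linarith
    rw [neg_mul, neg_nonpos] at h2
    have h4 := nonneg_of_mul_nonneg_right h2 (by positivity)
    linarith

lemma inner_indicatorConstLp_eq {E : Set ℝ} (hE : MeasurableSet E) (Y : L2) :
    ⟪indicatorConstLp 2 hE (measure_ne_top mu E) (1 : ℝ), Y⟫ = ∫ x in E, Y x ∂mu :=
  L2.inner_indicatorConstLp_one hE (measure_ne_top mu E) Y

/-- The elementary normal vector: the difference of the normalized indicators of two sets, one to
the left of the other, inside the same plateau. -/
lemma indicator_sub_indicator_mem_normalCone {X : L2} {g : ℝ → ℝ} (hXg : ⇑X =ᵐ[mu] g)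
    {v c : ℝ} (hc : c ∈ Omg) {E F : Set ℝ} (hE : MeasurableSet E) (hF : MeasurableSet F)
    (hEI : E ⊆ levelSet g v ∩ Iic c) (hFI : F ⊆ levelSet g v ∩ Ici c) :
    mu.real F • indicatorConstLp 2 hE (measure_ne_top mu E) (1 : ℝ) -
      mu.real E • indicatorConstLp 2 hF (measure_ne_top mu F) (1 : ℝ) ∈ normalCone X := by
  rintro Y ⟨y, hy, hYy⟩
  have hconst : ∀ (S : Set ℝ) (k : ℝ), ∫ _ in S, k ∂mu = mu.real S * k := fun S k => by
    rw [setIntegral_const, smul_eq_mul]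
  have hXint : ∀ S, MeasurableSet S → S ⊆ levelSet g v → ∫ x in S, X x ∂mu = mu.real S * v := by
    intro S hS hSI
    rw [← hconst]
    refine setIntegral_congr_ae hS ?_
    filter_upwards [hXg] with x hx hxS
    exact hx.trans (hSI hxS).2
  have hYE : ∫ x in E, Y x ∂mu ≤ mu.real E * y c := by
    rw [← hconst]
    refine setIntegral_mono_on_ae (integrable_coeFn Y).integrableOn
      (integrable_const _).integrableOn hE ?_
    filter_upwards [hYy] with x hx hxE
    rw [hx]
    exact hy (hEI hxE).1.1 hc (hEI hxE).2
  have hYF : mu.real F * y c ≤ ∫ x in F, Y x ∂mu := by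
    rw [← hconst]
    refine setIntegral_mono_on_ae (integrable_const _).integrableOn
      (integrable_coeFn Y).integrableOn hF ?_
    filter_upwards [hYy] with x hx hxF
    rw [hx]
    exact hy hc (hFI hxF).1.1 (hFI hxF).2
  rw [inner_sub_right, inner_sub_left, inner_sub_left]
  simp only [real_inner_smul_left, inner_indicatorConstLp_eq]
  rw [hXint E hE (hEI.trans inter_subset_left), hXint F hF (hFI.trans inter_subset_left)]
  have h1 := mul_le_mul_of_nonneg_left hYE (measureReal_nonneg (μ := mu) (s := F))
  have h2 := mul_le_mul_of_nonneg_left hYF (measureReal_nonneg (μ := mu) (s := E))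
  linarith

/-- If a function has, over every measurable subset of `S`, the same mean as the constant `k`,
then it equals `k` almost everywhere on `S`. -/
lemma ae_eq_const_on {Z : L2} {S : Set ℝ} (hS : MeasurableSet S) {k : ℝ}
    (h : ∀ E, MeasurableSet E → E ⊆ S → ∫ x in E, Z x ∂mu = mu.real E * k) :
    ∀ᵐ x ∂mu, x ∈ S → Z x = k := by
  have hint : Integrable (fun x => Z x - k) mu := (integrable_coeFn Z).sub (integrable_const k)
  have hzero : S.indicator (fun x => Z x - k) =ᵐ[mu] 0 := by
    refine (hint.indicator hS).ae_eq_zero_of_forall_setIntegral_eq_zero fun E hE _ => ?_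
    rw [setIntegral_indicator hS, integral_sub (integrable_coeFn Z).integrableOn
      (integrable_const k).integrableOn, h _ (hE.inter hS) inter_subset_right, setIntegral_const,
      smul_eq_mul, sub_self]
  filter_upwards [hzero] with x hx hxS
  rw [indicator_of_mem hxS] at hx
  exact sub_eq_zero.1 hx

lemma measureReal_pos_of_isOpen {S : Set ℝ} (hS : IsOpen S) (hne : S.Nonempty) (hSO : S ⊆ Omg) :
    0 < mu.real S := by
  refine ENNReal.toReal_pos ?_ (measure_ne_top _ _)
  rw [mu, Measure.restrict_eq_self _ hSO]
  exact (hS.measure_pos volume hne).ne'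

lemma exists_ae_eq_const_on_plateau {X Z : L2} {g : ℝ → ℝ} (hXg : ⇑X =ᵐ[mu] g)
    (hZ : ∀ W ∈ normalCone X, ⟪W, Z⟫ = 0) {v : ℝ} (hv : v ∈ plateauHeights g) :
    ∃ k, ∀ᵐ x ∂mu, x ∈ interior (levelSet g v) → Z x = k := by
  obtain ⟨c, hc⟩ := hv
  obtain ⟨a, b, hcab, hab⟩ := mem_nhds_iff_exists_Ioo_subset.1 (isOpen_interior.mem_nhds hc)
  have hcO : c ∈ Omg := interior_levelSet_subset g v hc
  set L := interior (levelSet g v) ∩ Iio c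
  set R := interior (levelSet g v) ∩ Ioi c
  have hLo : IsOpen L := isOpen_interior.inter isOpen_Iio
  have hRo : IsOpen R := isOpen_interior.inter isOpen_Ioi
  have hLpos : 0 < mu.real L := by
    obtain ⟨x, hx⟩ := exists_between hcab.1
    exact measureReal_pos_of_isOpen hLo ⟨x, hab ⟨hx.1, hx.2.trans hcab.2⟩, hx.2⟩
      (inter_subset_left.trans (interior_levelSet_subset g v))
  have hRpos : 0 < mu.real R := by
    obtain ⟨x, hx⟩ := exists_between hcab.2
    exact measureReal_pos_of_isOpen hRo ⟨x, hab ⟨hcab.1.trans hx.1, hx.2⟩, hx.1⟩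
      (inter_subset_left.trans (interior_levelSet_subset g v))
  have hmean : ∀ E F, MeasurableSet E → MeasurableSet F → E ⊆ L → F ⊆ R →
      mu.real F * ∫ x in E, Z x ∂mu = mu.real E * ∫ x in F, Z x ∂mu := by
    intro E F hE hF hEL hFR
    have h := hZ _ (indicator_sub_indicator_mem_normalCone hXg hcO hE hF
      (fun x hx => ⟨interior_subset (hEL hx).1, le_of_lt (mem_Iio.1 (hEL hx).2)⟩)
      (fun x hx => ⟨interior_subset (hFR hx).1, le_of_lt (mem_Ioi.1 (hFR hx).2)⟩))
    rw [inner_sub_left, real_inner_smul_left, real_inner_smul_left, inner_indicatorConstLp_eq,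
      inner_indicatorConstLp_eq] at h
    exact sub_eq_zero.1 h
  have hLR := hmean L R hLo.measurableSet hRo.measurableSet Subset.rfl Subset.rfl
  refine ⟨(∫ x in L, Z x ∂mu) / mu.real L, ?_⟩
  have hZL := ae_eq_const_on (Z := Z) (k := (∫ x in L, Z x ∂mu) / mu.real L) hLo.measurableSet
    fun E hE hEL => by
      have h := hmean E R hE hRo.measurableSet hEL Subset.rfl
      have hk : (∫ x in L, Z x ∂mu) / mu.real L = (∫ x in R, Z x ∂mu) / mu.real R := by
        rw [div_eq_div_iff hLpos.ne' hRpos.ne']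
        linarith
      rw [hk, mul_div_assoc', eq_div_iff hRpos.ne']
      linarith
  have hZR := ae_eq_const_on (Z := Z) (k := (∫ x in L, Z x ∂mu) / mu.real L) hRo.measurableSet
    fun F hF hFR => by
      have h := hmean L F hLo.measurableSet hF Subset.rfl hFR
      rw [mul_div_assoc', eq_div_iff hLpos.ne']
      linarith
  have hne : ∀ᵐ x ∂mu, x ≠ c :=
    ae_restrict_of_ae (measure_eq_zero_iff_ae_notMem.1 (measure_singleton (μ := volume) c))
  filter_upwards [hZL, hZR, hne] with x h1 h2 hxc hx
  rcases hxc.lt_or_gt with h | h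
  · exact h1 ⟨hx, h⟩
  · exact h2 ⟨hx, h⟩

lemma mem_HX_of_orthogonal_normalCone {X Z : L2} (hX : X ∈ Kcone)
    (hZ : ∀ W ∈ normalCone X, ⟪W, Z⟫ = 0) : Z ∈ HX X := by
  classical
  obtain ⟨g, hg, hXg⟩ := hX
  choose! k hk using fun v hv => exists_ae_eq_const_on_plateau (v := v) hXg hZ hv
  refine ⟨fun x => if x ∈ OmegaX X then k (g x) else Z x, ?_, fun m hm m' hm' => ?_⟩
  · filter_upwards [(ae_ball_iff (countable_plateauHeights g)).2 hk] with x hx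
    split_ifs with hxO
    · have hxI := (mem_OmegaX_iff hg hXg).1 hxO
      exact hx _ ⟨x, hxI⟩ hxI
    · rfl
  · have hm'O := connectedComponentIn_subset _ _ hm'
    rw [connectedComponentIn_OmegaX hg hXg hm] at hm'
    simp only [hm, hm'O, if_true, eq_of_mem_interior_levelSet hm']

lemma HXperp_eq_orthogonal (X : L2) :
    HXperp X = ((Submodule.span ℝ (HX X))ᗮ : Submodule ℝ L2) := by
  ext W
  refine ⟨fun hW => (Submodule.mem_orthogonal' _ _).2 fun U hU => ?_, fun hW U hU =>
    (Submodule.mem_orthogonal' _ _).1 hW U (Submodule.subset_span hU)⟩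
  induction hU using Submodule.span_induction with
  | mem U hU => exact hW U hU
  | zero => exact inner_zero_right _
  | add U V _ _ h1 h2 => rw [inner_add_right, h1, h2, add_zero]
  | smul a U _ h => rw [inner_smul_right, h, mul_zero]

lemma HXperp_eq_closure_span_normalCone {X : L2} (hX : X ∈ Kcone) :
    HXperp X = closure (Submodule.span ℝ (normalCone X) : Set L2) := by
  apply Subset.antisymm
  · intro W hW
    rw [← Submodule.topologicalClosure_coe, ← Submodule.orthogonal_orthogonal_eq_closure]
    refine (Submodule.mem_orthogonal' _ _).2 fun Z hZ => hW Z ?_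
    exact mem_HX_of_orthogonal_normalCone hX fun V hV =>
      (Submodule.mem_orthogonal _ _).1 hZ V (Submodule.subset_span hV)
  · have hsub : normalCone X ⊆ HXperp X := fun W hW => mem_HXperp_of_mem_normalCone hX hW
    rw [HXperp_eq_orthogonal] at hsub ⊢
    exact closure_minimal (Submodule.span_le.2 hsub) (Submodule.isClosed_orthogonal _)

lemma vanishesWithZeroAverages_of_integral_mul_comp_eq_zero {X W : L2} (hX : X ∈ Kcone)
    (h : ∀ φ : ℝ → ℝ, Continuous φ → (∃ M : ℝ, ∀ x : ℝ, |φ x| ≤ M) →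
      ∫ m, W m * φ (X m) ∂mu = 0) : VanishesWithZeroAverages X W := by
  refine vanishesWithZeroAverages_of_ramp hX ?_ fun v n =>
    h _ (continuous_ramp v n) ⟨1, abs_ramp_le_one v n⟩
  simpa using h (fun _ => 1) continuous_const ⟨1, by simp⟩

/-- For `X ∈ K`:
(a) `H_X^⊥` consists of the `W ∈ L²(Ω)` vanishing a.e. outside `Ω_X` and with zero average
on each connected component of `Ω_X`;
(b) `H_X^⊥` is the smallest closed linear subspace containing the normal cone `N_X K`,
i.e. the closure of the span of `N_X K`;
(c) `H_X^⊥ = {W : ∫₀¹ W(m) φ(X(m)) dm = 0 for every bounded continuous φ : ℝ → ℝ}`. -/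
theorem stmt5 (X : L2) (hX : X ∈ Kcone) :
    (HXperp X =
      {W : L2 | (∀ᵐ m ∂mu, m ∉ OmegaX X → W m = 0) ∧
        ∀ m ∈ OmegaX X, (∫ s in connectedComponentIn (OmegaX X) m, W s) = 0}) ∧
    (HXperp X = closure (Submodule.span ℝ (normalCone X) : Set L2)) ∧
    (HXperp X =
      {W : L2 | ∀ φ : ℝ → ℝ, Continuous φ → (∃ M : ℝ, ∀ x : ℝ, |φ x| ≤ M) →
        (∫ m, W m * φ (X m) ∂mu) = 0}) := by
  refine ⟨Subset.antisymm (fun W hW => ?_) fun W hW =>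
      mem_HXperp_of_vanishesWithZeroAverages hX hW,
    HXperp_eq_closure_span_normalCone hX, Subset.antisymm (fun W hW φ hφ ⟨_, hM⟩ =>
      integral_mul_comp_eq_zero_of_mem_HXperp hX hW hφ hM) fun W hW =>
      mem_HXperp_of_vanishesWithZeroAverages hX
        (vanishesWithZeroAverages_of_integral_mul_comp_eq_zero hX hW)⟩
  exact vanishesWithZeroAverages_of_integral_mul_comp_eq_zero hX fun φ hφ ⟨_, hM⟩ =>
    integral_mul_comp_eq_zero_of_mem_HXperp hX hW hφ hM
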